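/- arXiv:1507.08171 — 7 statements merged into one kernel-verified Lean document; each statement's English description precedes it below -/
import Mathlib

section
/- Let E be a finite-dimensional complex inner product space with dim E ≥ 2, and let ψ₀, ψ₁ ∈ E be unit vectors. Then there exist two orthonormal vectors η₊, η₋ ∈ E such that |⟪η_s, ψ_k⟫|² = 1/2 for every s ∈ {+,−} and every k ∈ {0,1} (i.e., {η₊, η₋} is mutually unbiased with respect to both ψ₀ and ψ₁). -/
open scoped InnerProductSpace

lemma aux_orth (E : Type*) [NormedAddCommGroup E] [InnerProductSpace ℂ E]
    [FiniteDimensional ℂ E] (hdim : 2 ≤ Module.finrank ℂ E) (x : E) :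
    ∃ w : E, w ≠ 0 ∧ ⟪x, w⟫_ℂ = 0 := by
  by_contra! h
  have h1 : (Submodule.span ℂ {x})ᗮ = ⊥ := by
    rw [Submodule.eq_bot_iff]
    intro w hw
    by_contra hw0
    exact h w hw0 (Submodule.mem_orthogonal_singleton_iff_inner_right.1 hw)
  have h2 : Submodule.span ℂ {x} = ⊤ := (Submodule.orthogonal_eq_bot_iff).1 h1
  have h3 := finrank_span_le_card (R := ℂ) ({x} : Set E)
  rw [h2, finrank_top] at h3
  simp at h3
  omega

lemma aux_decomp (E : Type*) [NormedAddCommGroup E] [InnerProductSpace ℂ E]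
    [FiniteDimensional ℂ E] (hdim : 2 ≤ Module.finrank ℂ E) (x y : E) (hx : ‖x‖ = 1) :
    ∃ (e : E) (a b : ℂ), ‖e‖ = 1 ∧ ⟪x, e⟫_ℂ = 0 ∧ y = a • x + b • e := by
  obtain ⟨w, b, hw, hxw, hy⟩ : ∃ (w : E) (b : ℂ), w ≠ 0 ∧ ⟪x, w⟫_ℂ = 0 ∧
      y = ⟪x, y⟫_ℂ • x + b • w := by
    by_cases h : y - ⟪x, y⟫_ℂ • x = 0
    · obtain ⟨w, hw, hxw⟩ := aux_orth E hdim x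
      exact ⟨w, 0, hw, hxw, by simpa using sub_eq_zero.1 h⟩
    · refine ⟨_, 1, h, ?_, by simp⟩
      rw [inner_sub_right, inner_smul_right, inner_self_eq_norm_sq_to_K, hx]
      simp
  have hn : (‖w‖ : ℂ) ≠ 0 := by simpa using hw
  refine ⟨(‖w‖ : ℂ)⁻¹ • w, ⟪x, y⟫_ℂ, b * ‖w‖, ?_, ?_, ?_⟩
  · rw [norm_smul]; simp [hw]
  · rw [inner_smul_right, hxw, mul_zero]
  · rw [smul_smul, mul_assoc, mul_inv_cancel₀ hn, mul_one]; exact hy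

lemma aux_phase (z : ℂ) : ∃ u : ℂ, ‖u‖ = 1 ∧ (star u * z).re = 0 := by
  by_cases hz : z = 0
  · exact ⟨1, by simp, by simp [hz]⟩
  · refine ⟨Complex.I * (z / ‖z‖), by simp [hz], ?_⟩
    have : star (Complex.I * (z / ‖z‖)) * z = -Complex.I * ((star z * z) / ‖z‖) := by
      simp; ring
    rw [this]
    have h2 : star z * z = ((‖z‖ ^ 2 : ℝ) : ℂ) := by
      rw [Complex.star_def, Complex.conj_mul']; simp
    rw [h2, ← Complex.ofReal_div, Complex.re_mul_ofReal]
    simp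

/-- In a finite-dimensional complex inner product space of dimension at
least 2, for any two unit vectors `ψ 0, ψ 1` there exists an orthonormal pair `η 0, η 1`
(playing the role of `η₊, η₋`) that is mutually unbiased with respect to both:
`|⟪η s, ψ k⟫|² = 1/2` for all `s, k`. -/
theorem exists_mutually_unbiased_pair
    (E : Type*) [NormedAddCommGroup E] [InnerProductSpace ℂ E]
    [FiniteDimensional ℂ E] (hdim : 2 ≤ Module.finrank ℂ E)
    (ψ : Fin 2 → E) (hψ : ∀ k, ‖ψ k‖ = 1) :
    ∃ η : Fin 2 → E, Orthonormal ℂ η ∧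
      ∀ s k : Fin 2, ‖(⟪η s, ψ k⟫_ℂ : ℂ)‖ ^ 2 = 1 / 2 := by
  obtain ⟨e, a, b, he, hxe, hy⟩ := aux_decomp E hdim (ψ 0) (ψ 1) (hψ 0)
  obtain ⟨u, hu, huz⟩ := aux_phase (star a * b)
  have hex : ⟪e, ψ 0⟫_ℂ = 0 := inner_eq_zero_symm.1 hxe
  have hxx : ⟪ψ 0, ψ 0⟫_ℂ = 1 := by rw [inner_self_eq_norm_sq_to_K, hψ 0]; simp
  have hee : ⟪e, e⟫_ℂ = 1 := by rw [inner_self_eq_norm_sq_to_K, he]; simp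
  have hyy : ⟪ψ 1, ψ 1⟫_ℂ = 1 := by rw [inner_self_eq_norm_sq_to_K, hψ 1]; simp
  have huu : star u * u = 1 := by
    rw [Complex.star_def, Complex.conj_mul', hu]; simp
  have hab : star a * a + star b * b = 1 := by
    rw [hy] at hyy
    simp only [inner_add_left, inner_add_right, inner_smul_left, inner_smul_right,
      hxx, hee, hxe, hex] at hyy
    simp only [Complex.star_def]
    linear_combination hyy
  have him : star u * (star a * b) + u * (a * star b) = 0 := by
    have h := Complex.add_conj (star u * (star a * b))
    rw [huz] at h
    simpa using h
  have hr : ((Real.sqrt 2 : ℝ) : ℂ)⁻¹ * ((Real.sqrt 2 : ℝ) : ℂ)⁻¹ = 1 / 2 := by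
    rw [← mul_inv, ← Complex.ofReal_mul, Real.mul_self_sqrt (by norm_num)]; simp
  have key : ∀ z : ℂ, star z * z = 1 / 2 → ‖z‖ ^ 2 = 1 / 2 := by
    intro z hz
    rw [Complex.star_def, Complex.conj_mul'] at hz
    have : ((‖z‖ ^ 2 : ℝ) : ℂ) = ((1 / 2 : ℝ) : ℂ) := by push_cast; exact hz
    exact_mod_cast this
  have hsgn : ∃ ε : Fin 2 → ℂ, ε 0 = 1 ∧ ε 1 = -1 := ⟨![1, -1], by simp, by simp⟩
  obtain ⟨ε, h0, h1⟩ := hsgn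
  have hε : ∀ s, star (ε s) = ε s ∧ ε s * ε s = 1 := by
    intro s; fin_cases s <;> simp [h0, h1]
  simp only [Complex.star_def] at huu hab him hε key
  set c : ℂ := ((Real.sqrt 2 : ℝ) : ℂ)⁻¹ with hc
  have hcc : (starRingEnd ℂ) c = c := by simp [hc]
  clear_value c
  have hη : ∀ s t, ⟪c • (ψ 0 + (ε s * u) • e), c • (ψ 0 + (ε t * u) • e)⟫_ℂ
      = 1 / 2 * (1 + ε s * ε t) := by
    intro s t
    simp only [inner_add_left, inner_add_right, inner_smul_left, inner_smul_right,
      hxx, hee, hxe, hex, map_mul, hcc, (hε s).1]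
    linear_combination (1 + ε s * ε t) * hr + c * c * ε s * ε t * huu
  refine ⟨fun s => c • (ψ 0 + (ε s * u) • e), ?_, ?_⟩
  · rw [orthonormal_iff_ite]
    intro s t
    rw [hη]
    fin_cases s <;> fin_cases t <;> simp [h0, h1] <;> norm_num
  · intro s k
    apply key
    obtain ⟨hs1, hs2⟩ := hε s
    fin_cases k
    · simp only [Fin.zero_eta, inner_add_left, inner_smul_left, hxx, hex, map_mul, hcc, map_add,
        map_one, map_zero]
      linear_combination hr
    · simp only [Fin.mk_one, hy, inner_add_left, inner_add_right, inner_smul_left,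
        inner_smul_right, hxx, hee, hxe, hex, map_mul, hcc, map_add,
        map_one, map_zero, hs1, Complex.conj_conj]
      linear_combination hr + c * c * hab + c * c * ε s * him +
        c * c * b * (starRingEnd ℂ) b * (hs2 * u * (starRingEnd ℂ) u + huu)
end

section
/- For every 2×2 complex density matrix ρ there exist unit vectors φ₊, φ₋ ∈ ℂ² such that ρ = (1/2)·φ₊φ₊† + (1/2)·φ₋φ₋† and |φ₊(0)|² = |φ₋(0)|² = ρ₀₀ (the (0,0) diagonal entry of ρ, viewed as a real number). Consequently the coherence of assistance of a qubit state ρ is at least the binary entropy h(ρ₀₀) of its diagonal, i.e. C_a(ρ) ≥ S(Δ(ρ)). -/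
open scoped ComplexOrder

/-- The binary (Shannon) entropy `h(x) = −x·log₂ x − (1−x)·log₂(1−x)`. -/
noncomputable def binEntropy (x : ℝ) : ℝ :=
  -(x * Real.logb 2 x) - (1 - x) * Real.logb 2 (1 - x)

/-- Every point of the closed unit disc is the midpoint of two unit complex numbers. -/
theorem exists_unit_midpoint (z : ℂ) (hz : ‖z‖ ≤ 1) :
    ∃ u v : ℂ, ‖u‖ = 1 ∧ ‖v‖ = 1 ∧ u + v = 2 * z := by
  obtain ⟨e, he, hze⟩ : ∃ e : ℂ, ‖e‖ = 1 ∧ z = ‖z‖ * e :=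
    ⟨Complex.exp (Complex.arg z * Complex.I), Complex.norm_exp_ofReal_mul_I _,
      (Complex.norm_mul_exp_arg_mul_I z).symm⟩
  have hn := norm_nonneg z
  have hs : Real.sqrt (1 - ‖z‖ ^ 2) ^ 2 = 1 - ‖z‖ ^ 2 := Real.sq_sqrt (by nlinarith)
  set r := ‖z‖
  set s := Real.sqrt (1 - r ^ 2)
  have key : ∀ t : ℝ, t ^ 2 = 1 - r ^ 2 → ‖e * (⟨r, t⟩ : ℂ)‖ = 1 := by
    intro t ht
    have h2 : ‖(⟨r, t⟩ : ℂ)‖ ^ 2 = 1 := by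
      rw [Complex.sq_norm, Complex.normSq_mk]; linarith
    rw [norm_mul, he, one_mul]
    exact (pow_eq_one_iff_of_nonneg (norm_nonneg _) two_ne_zero).mp h2
  refine ⟨e * ⟨r, s⟩, e * ⟨r, -s⟩, key s hs, key (-s) (by rw [neg_sq]; exact hs), ?_⟩
  have : (⟨r, s⟩ : ℂ) + ⟨r, -s⟩ = 2 * (r : ℂ) := by
    apply Complex.ext <;> simp <;> ring
  rw [← mul_add, this]
  conv_rhs => rw [hze]
  ring

/-- achievability part of Theorem 5.  Every 2×2 density matrix `ρ`
admits a decomposition `ρ = (1/2)·φ₊φ₊† + (1/2)·φ₋φ₋†` into two unit vectors whose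
zeroth amplitudes both satisfy `|φ±(0)|² = ρ₀₀`.  Consequently the coherence of
assistance of `ρ` is at least `h(ρ₀₀) = S(Δ(ρ))`. -/
theorem qubit_coa_achievability
    (ρ : Matrix (Fin 2) (Fin 2) ℂ) (hρ : ρ.PosSemidef) (htr : ρ.trace = 1) :
    ∃ φp φm : Fin 2 → ℂ,
      (∑ i, ‖φp i‖ ^ 2 = 1) ∧ (∑ i, ‖φm i‖ ^ 2 = 1) ∧
      ρ = (1 / 2 : ℝ) • Matrix.vecMulVec φp (star φp)
          + (1 / 2 : ℝ) • Matrix.vecMulVec φm (star φm) ∧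
      ‖φp 0‖ ^ 2 = (ρ 0 0).re ∧ ‖φm 0‖ ^ 2 = (ρ 0 0).re ∧
      (1 / 2 : ℝ) * binEntropy (‖φp 0‖ ^ 2)
        + (1 / 2 : ℝ) * binEntropy (‖φm 0‖ ^ 2) = binEntropy ((ρ 0 0).re) := by
  have h0 : 0 ≤ ρ 0 0 := hρ.diag_nonneg
  have h1 : 0 ≤ ρ 1 1 := hρ.diag_nonneg
  have hdet : 0 ≤ ρ.det := hρ.det_nonneg
  have hH : ρ 0 1 = star (ρ 1 0) := (hρ.1.apply 0 1).symm
  obtain ⟨ha, ha'⟩ := Complex.nonneg_iff.mp h0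
  obtain ⟨hb, hb'⟩ := Complex.nonneg_iff.mp h1
  have h00 : ρ 0 0 = ((ρ 0 0).re : ℂ) := Complex.ext (by simp) (by simp [← ha'])
  have h11 : ρ 1 1 = ((ρ 1 1).re : ℂ) := Complex.ext (by simp) (by simp [← hb'])
  have hab : (ρ 0 0).re + (ρ 1 1).re = 1 := by
    have := congrArg Complex.re htr
    simpa [Matrix.trace_fin_two] using this
  have hc : ‖ρ 1 0‖ ^ 2 ≤ (ρ 0 0).re * (ρ 1 1).re := by
    have := (Complex.nonneg_iff.mp hdet).1
    rw [Matrix.det_fin_two, hH] at this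
    simp [← ha', ← hb'] at this
    rw [Complex.sq_norm, Complex.normSq_apply]
    linarith
  set a := (ρ 0 0).re
  set b := (ρ 1 1).re
  have hsa := Real.sq_sqrt ha
  have hsb := Real.sq_sqrt hb
  set x := Real.sqrt a with hx
  set y := Real.sqrt b with hy
  have hx0 : 0 ≤ x := Real.sqrt_nonneg _
  have hy0 : 0 ≤ y := Real.sqrt_nonneg _
  have hcn : ‖ρ 1 0‖ ≤ x * y := by
    apply le_of_sq_le_sq _ (mul_nonneg hx0 hy0)
    rw [mul_pow, hsa, hsb]; exact hc
  obtain ⟨z, hz, hzc⟩ : ∃ z : ℂ, ‖z‖ ≤ 1 ∧ ρ 1 0 = x * y * z := by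
    refine ⟨ρ 1 0 / ((x * y : ℝ) : ℂ), ?_, ?_⟩
    · rw [norm_div, Complex.norm_real, Real.norm_of_nonneg (mul_nonneg hx0 hy0)]
      exact div_le_one_of_le₀ hcn (mul_nonneg hx0 hy0)
    · by_cases h : x * y = 0
      · rw [h] at hcn
        have : ρ 1 0 = 0 := norm_le_zero_iff.mp hcn
        simp [this]
      · have h' : ((x * y : ℝ) : ℂ) ≠ 0 := by exact_mod_cast h
        rw [← Complex.ofReal_mul, mul_div_cancel₀ _ h']
  obtain ⟨u, v, hu, hv, huv⟩ := exists_unit_midpoint z hz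
  have hxx : (x : ℂ) * x = a := by rw [← hsa]; push_cast; ring
  have hyy : (y : ℂ) * y = b := by rw [← hsb]; push_cast; ring
  have huu : u * star u = 1 := by
    have := Complex.mul_conj' u
    rw [hu] at this; simpa using this
  have hvv : v * star v = 1 := by
    have := Complex.mul_conj' v
    rw [hv] at this; simpa using this
  have huv' : star u + star v = 2 * star z := by
    rw [← star_add, huv]; simp
  have n0 : ‖(x : ℂ)‖ ^ 2 = a := by
    rw [Complex.norm_real, Real.norm_of_nonneg hx0, hsa]
  have n1 : ∀ w : ℂ, ‖w‖ = 1 → ‖(y : ℂ) * w‖ ^ 2 = b := by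
    intro w hw
    rw [norm_mul, hw, mul_one, Complex.norm_real, Real.norm_of_nonneg hy0, hsb]
  refine ⟨![x, y * u], ![x, y * v], ?_, ?_, ?_, ?_, ?_, ?_⟩
  · rw [Fin.sum_univ_two]
    change ‖(x : ℂ)‖ ^ 2 + ‖(y : ℂ) * u‖ ^ 2 = 1
    rw [n0, n1 u hu, hab]
  · rw [Fin.sum_univ_two]
    change ‖(x : ℂ)‖ ^ 2 + ‖(y : ℂ) * v‖ ^ 2 = 1
    rw [n0, n1 v hv, hab]
  · simp only [Complex.star_def] at *
    ext i j
    rw [Matrix.add_apply, Matrix.smul_apply, Matrix.smul_apply, Matrix.vecMulVec_apply,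
      Matrix.vecMulVec_apply, Pi.star_apply, Pi.star_apply, Complex.real_smul, Complex.real_smul]
    fin_cases i <;> fin_cases j <;> simp
    · rw [h00]; linear_combination -hxx
    · rw [hH, hzc]; simp; linear_combination (-(x * y : ℂ) / 2) * huv'
    · rw [hzc]; linear_combination (-(x * y : ℂ) / 2) * huv
    · rw [h11]; linear_combination -hyy - (y * y : ℂ) / 2 * (huu + hvv)
  · exact n0
  · exact n0
  · change (1 / 2 : ℝ) * binEntropy (‖(x : ℂ)‖ ^ 2)
        + (1 / 2 : ℝ) * binEntropy (‖(x : ℂ)‖ ^ 2) = binEntropy a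
    rw [n0]; ring
end

section
/- Let ρ be a 2×2 complex density matrix and let ρ = Σ_{k ∈ K} p_k · ψ_k ψ_k† be any finite pure-state decomposition of ρ, where K is a finite index set, p_k ≥ 0 with Σ_k p_k = 1, and each ψ_k ∈ ℂ² is a unit vector. Then Σ_{k} p_k · h(|ψ_k(0)|²) ≤ h(ρ₀₀), where ρ₀₀ is the (0,0) diagonal entry of ρ (a real number). Hence the coherence of assistance of a qubit state ρ satisfies C_a(ρ) ≤ S(Δ(ρ)). -/
open scoped ComplexOrder

lemma binEntropy_eq_real (x : ℝ) :
    binEntropy x = (Real.log 2)⁻¹ * Real.binEntropy x := by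
  rw [Real.binEntropy_eq_negMulLog_add_negMulLog_one_sub]
  simp only [binEntropy, Real.logb, Real.negMulLog]
  ring

/-- optimality part of Theorem 5.  For every finite pure-state
decomposition `ρ = Σ_k p_k ψ_k ψ_k†` of a 2×2 density matrix `ρ`, the average binary
entropy of the diagonals is at most the binary entropy of the diagonal of `ρ`:
`Σ_k p_k h(|ψ_k(0)|²) ≤ h(ρ₀₀)`.  Hence `C_a(ρ) ≤ S(Δ(ρ))` for a qubit state. -/
theorem qubit_coa_optimality
    (ρ : Matrix (Fin 2) (Fin 2) ℂ) (hρ : ρ.PosSemidef) (htr : ρ.trace = 1)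
    (K : Type*) [Fintype K] (p : K → ℝ) (ψ : K → Fin 2 → ℂ)
    (hp : ∀ k, 0 ≤ p k) (hpsum : ∑ k, p k = 1)
    (hψ : ∀ k, ∑ i, ‖ψ k i‖ ^ 2 = 1)
    (hdec : ρ = ∑ k, p k • Matrix.vecMulVec (ψ k) (star (ψ k))) :
    ∑ k, p k * binEntropy (‖ψ k 0‖ ^ 2) ≤ binEntropy ((ρ 0 0).re) := by
  have hx : (ρ 0 0).re = ∑ k, p k • (‖ψ k 0‖ ^ 2) := by
    rw [hdec, Matrix.sum_apply, Complex.re_sum]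
    refine Finset.sum_congr rfl fun k _ => ?_
    simp [Matrix.vecMulVec_apply, Complex.mul_conj, Complex.normSq_eq_norm_sq,
      -Complex.ofReal_pow]
  have hmem : ∀ k ∈ Finset.univ, ‖ψ k 0‖ ^ 2 ∈ Set.Icc (0 : ℝ) 1 := by
    intro k _
    have h := hψ k
    rw [Fin.sum_univ_two] at h
    exact ⟨by positivity, by nlinarith [sq_nonneg ‖ψ k 1‖]⟩
  have hJ := Real.strictConcave_binEntropy.concaveOn.le_map_sum
    (fun k _ => hp k) hpsum hmem
  rw [hx, binEntropy_eq_real]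
  have hl : 0 ≤ (Real.log 2)⁻¹ := inv_nonneg.2 (Real.log_nonneg (by norm_num))
  refine le_trans (le_of_eq ?_) (mul_le_mul_of_nonneg_left hJ hl)
  rw [Finset.mul_sum]
  refine Finset.sum_congr rfl fun k _ => ?_
  rw [binEntropy_eq_real, smul_eq_mul]
  ring
end

section
/- Let ρ be a positive semidefinite complex matrix indexed by (Fin m × Fin n) × (Fin m × Fin n) that is not quantum-incoherent, i.e. Δ^B(ρ) ≠ ρ where Δ^B zeroes out all entries ρ_{(i,j),(i',j')} with j ≠ j'. Then there exists a unit vector a ∈ ℂ^m such that the n×n matrix N_a defined by (N_a)_{j,l} = Σ_{i,i' ∈ Fin m} conj(a(i)) · ρ_{(i,j),(i',l)} · a(i') is not diagonal, i.e. (N_a)_{j,l} ≠ 0 for some j ≠ l. (Operationally: if ρ^{AB} is not quantum-incoherent, Alice has a rank-one projective measurement outcome occurring with nonzero probability whose post-measurement state on Bob's side has nonzero coherence.) -/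
open scoped ComplexOrder

/-- The dephasing of a bipartite operator in Bob's incoherent basis:
all entries whose two `B`-indices differ are set to zero. -/
def dephaseB {m n : ℕ} (ρ : Matrix (Fin m × Fin n) (Fin m × Fin n) ℂ) :
    Matrix (Fin m × Fin n) (Fin m × Fin n) ℂ :=
  Matrix.of fun p q => if p.2 = q.2 then ρ p q else 0

theorem aux_quad {m : ℕ} (M : Fin m → Fin m → ℂ)
    (h : ∀ a : Fin m → ℂ, ∑ i, ∑ i', (starRingEnd ℂ) (a i) * M i i' * a i' = 0) (p q : Fin m) :
    M p q = 0 := by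
  have key : ∀ c : ℂ, M p p + M p q * c + (starRingEnd ℂ) c * M q p
      + (starRingEnd ℂ) c * M q q * c = 0 := by
    intro c
    have := h (fun i => (if i = p then 1 else 0) + (if i = q then c else 0))
    simp only [map_add, apply_ite (starRingEnd ℂ), map_one, map_zero, add_mul, mul_add,
      Finset.sum_add_distrib, ite_mul, mul_ite, zero_mul, mul_zero, one_mul, mul_one,
      Finset.sum_ite_eq', Finset.mem_univ, if_true] at this
    linear_combination this
  have h1 := key 1
  have h2 := key (-1)
  have h3 := key Complex.I
  have h4 := key (-Complex.I)
  simp only [map_one, map_neg, Complex.conj_I] at h1 h2 h3 h4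
  linear_combination (h1 - h2 - Complex.I * (h3 - h4)) / 4 + (M p q - M q p) / 2 * Complex.I_sq

theorem nonQI_gives_coherent_outcome
    (m n : ℕ) (ρ : Matrix (Fin m × Fin n) (Fin m × Fin n) ℂ)
    (hρ : ρ.PosSemidef) (hQI : dephaseB ρ ≠ ρ) :
    ∃ a : Fin m → ℂ, (∑ i, ‖a i‖ ^ 2 = 1) ∧
      ∃ j l : Fin n, j ≠ l ∧
        (∑ i : Fin m, ∑ i' : Fin m,
            (starRingEnd ℂ) (a i) * ρ (i, j) (i', l) * a i') ≠ 0 := by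
  by_contra hcon
  push Not at hcon
  apply hQI
  ext ⟨p, j⟩ ⟨q, l⟩
  simp only [dephaseB, Matrix.of_apply]
  split_ifs with hjl
  · rfl
  symm
  refine aux_quad (fun i i' => ρ (i, j) (i', l)) (fun a => ?_) p q
  by_cases ha : ∑ i, ‖a i‖ ^ 2 = 0
  · have h0 : ∀ i, a i = 0 := by
      intro i
      have := (Finset.sum_eq_zero_iff_of_nonneg (fun i _ => sq_nonneg ‖a i‖)).1 ha i
        (Finset.mem_univ i)
      simpa using this
    simp [h0]
  · set S := ∑ i, ‖a i‖ ^ 2 with hS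
    have hS0 : 0 ≤ S := Finset.sum_nonneg (fun i _ => sq_nonneg ‖a i‖)
    have hr : Real.sqrt S ≠ 0 := by
      rw [Real.sqrt_ne_zero hS0]; exact ha
    have hrc : ((Real.sqrt S : ℝ) : ℂ) ≠ 0 := by exact_mod_cast hr
    have := hcon (fun i => ((Real.sqrt S : ℝ) : ℂ)⁻¹ * a i) (by
      simp only [norm_mul, mul_pow, ← Finset.mul_sum, ← hS]
      rw [norm_inv, Complex.norm_real, inv_pow, Real.norm_eq_abs, sq_abs, Real.sq_sqrt hS0]
      exact inv_mul_cancel₀ ha) j l hjl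
    have e : ∑ i : Fin m, ∑ i' : Fin m, (starRingEnd ℂ) (a i) * ρ (i, j) (i', l) * a i'
        = ((Real.sqrt S : ℝ) : ℂ) ^ 2 * ∑ i : Fin m, ∑ i' : Fin m,
          (starRingEnd ℂ) (((Real.sqrt S : ℝ) : ℂ)⁻¹ * a i) * ρ (i, j) (i', l)
            * (((Real.sqrt S : ℝ) : ℂ)⁻¹ * a i') := by
      simp only [Finset.mul_sum]
      refine Finset.sum_congr rfl fun i _ => Finset.sum_congr rfl fun i' _ => ?_
      rw [map_mul, map_inv₀, Complex.conj_ofReal]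
      field_simp
    exact e.trans (by rw [this, mul_zero])
end

section
/- Let ρ be a d×d complex density matrix and let ρ_mc be the maximally correlated matrix indexed by (Fin d × Fin d) × (Fin d × Fin d) with entries (ρ_mc)_{(i,i),(j,j)} = ρ_{i,j} and all other entries zero. Then the coherence of assistance of ρ equals the entanglement of assistance of ρ_mc: sSup { Σ_k p_k · H(fun i => |ψ_k(i)|²) : ρ = Σ_{k ∈ K} p_k ψ_k ψ_k† a finite decomposition with p_k ≥ 0, Σ p_k = 1, ψ_k ∈ ℂ^d unit vectors } = sSup { Σ_k q_k · S(Tr_C[φ_k φ_k†]) : ρ_mc = Σ_{k ∈ K} q_k φ_k φ_k† a finite decomposition with q_k ≥ 0, Σ q_k = 1, φ_k : Fin d × Fin d → ℂ unit vectors }, where H(v) = −Σ_i v_i log₂ v_i is the Shannon entropy of a probability vector, Tr_C[X]_{i,i'} = Σ_j X_{(i,j),(i',j)} is the partial trace over the second factor, and S(X) = −Σ_i λ_i log₂ λ_i is the von Neumann entropy computed from the eigenvalues λ_i of the Hermitian matrix X. -/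
open scoped ComplexOrder

/-- Shannon entropy (base 2) of a finite nonnegative vector: `H(v) = −Σ_i v_i log₂ v_i`. -/
noncomputable def shannonEntropy {d : ℕ} (v : Fin d → ℝ) : ℝ :=
  -∑ i, v i * Real.logb 2 (v i)

/-- Von Neumann entropy (base 2) of a complex matrix, computed from the eigenvalues of
its Hermitian structure (junk value `0` if the matrix is not Hermitian). -/
noncomputable def vonNeumannEntropy {d : Type*} [Fintype d] [DecidableEq d]
    (X : Matrix d d ℂ) : ℝ :=
  if hX : X.IsHermitian then -∑ i, hX.eigenvalues i * Real.logb 2 (hX.eigenvalues i)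
  else 0

/-- The partial trace over the second (C) factor: `Tr_C[X]_{i,i'} = Σ_j X_{(i,j),(i',j)}`. -/
noncomputable def ptraceC {d : ℕ} (X : Matrix (Fin d × Fin d) (Fin d × Fin d) ℂ) :
    Matrix (Fin d) (Fin d) ℂ :=
  Matrix.of fun i i' => ∑ j, X (i, j) (i', j)

lemma vN_diagonal {d : ℕ} (v : Fin d → ℝ) :
    vonNeumannEntropy (Matrix.diagonal (fun i => (v i : ℂ))) = shannonEntropy v := by
  have hX : (Matrix.diagonal (fun i => (v i : ℂ))).IsHermitian := by
    rw [Matrix.IsHermitian, Matrix.diagonal_conjTranspose]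
    congr 1
    ext i
    simp
  unfold vonNeumannEntropy shannonEntropy
  rw [dif_pos hX]
  have h := hX.roots_charpoly_eq_eigenvalues
  rw [Matrix.charpoly_diagonal, Polynomial.roots_prod _ _ (by
    simp [Finset.prod_ne_zero_iff, Polynomial.X_sub_C_ne_zero])] at h
  simp only [Polynomial.roots_X_sub_C, Multiset.bind_singleton] at h
  have h2 := congrArg (fun m => (Multiset.map
    (fun z : ℂ => z.re * Real.logb 2 z.re) m).sum) h
  simp only [Multiset.map_map, Function.comp_def] at h2
  congr 1
  simpa [List.sum_ofFn] using h2.symm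

lemma vN_ptrace {d : ℕ} (φ : Fin d × Fin d → ℂ) (h : ∀ i j, i ≠ j → φ (i, j) = 0) :
    vonNeumannEntropy (ptraceC (Matrix.vecMulVec φ (star φ)))
      = shannonEntropy (fun i => ‖φ (i, i)‖ ^ 2) := by
  rw [← vN_diagonal]
  congr 1
  ext i j
  simp only [ptraceC, Matrix.of_apply, Matrix.vecMulVec_apply, Pi.star_apply]
  rw [Finset.sum_eq_single i]
  · by_cases hij : i = j
    · subst hij
      simp [Complex.mul_conj, Complex.normSq_eq_norm_sq]
    · rw [h j i (Ne.symm hij)]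
      simp [hij]
  · intro b _ hb
    rw [h i b (Ne.symm hb)]
    simp
  · simp

lemma sum_prod_diag {d : ℕ} (φ : Fin d × Fin d → ℂ) (h : ∀ i j, i ≠ j → φ (i, j) = 0) :
    ∑ y, ‖φ y‖ ^ 2 = ∑ i, ‖φ (i, i)‖ ^ 2 := by
  rw [Fintype.sum_prod_type]
  refine Finset.sum_congr rfl fun i _ => ?_
  rw [Finset.sum_eq_single i]
  · intro b _ hb
    rw [h i b (Ne.symm hb)]
    simp
  · simp

/-- Eq. (10) of the paper: the coherence of assistance of a `d × d`
density matrix `ρ` equals the entanglement of assistance of the associated maximally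
correlated state `ρ_mc = Σ_{i,j} ρ_{ij}|ii⟩⟨jj|`.  Both quantities are expressed as
suprema over finite pure-state decompositions. -/
theorem coa_eq_eoa_maximally_correlated
    (d : ℕ) (ρ : Matrix (Fin d) (Fin d) ℂ) (hρ : ρ.PosSemidef) (htr : ρ.trace = 1)
    (ρmc : Matrix (Fin d × Fin d) (Fin d × Fin d) ℂ)
    (hmc : ∀ i i' j j', ρmc (i, i') (j, j') =
      if i = i' ∧ j = j' then ρ i j else 0) :
    sSup {x : ℝ | ∃ (K : ℕ) (p : Fin K → ℝ) (ψ : Fin K → Fin d → ℂ),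
        (∀ k, 0 ≤ p k) ∧ (∑ k, p k = 1) ∧
        (∀ k, ∑ i, ‖ψ k i‖ ^ 2 = 1) ∧
        ρ = ∑ k, p k • Matrix.vecMulVec (ψ k) (star (ψ k)) ∧
        x = ∑ k, p k * shannonEntropy (fun i => ‖ψ k i‖ ^ 2)}
    = sSup {x : ℝ | ∃ (K : ℕ) (q : Fin K → ℝ) (φ : Fin K → Fin d × Fin d → ℂ),
        (∀ k, 0 ≤ q k) ∧ (∑ k, q k = 1) ∧
        (∀ k, ∑ y, ‖φ k y‖ ^ 2 = 1) ∧
        ρmc = ∑ k, q k • Matrix.vecMulVec (φ k) (star (φ k)) ∧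
        x = ∑ k, q k *
          vonNeumannEntropy (ptraceC (Matrix.vecMulVec (φ k) (star (φ k))))} := by
  congr 1
  ext x
  constructor
  · rintro ⟨K, p, ψ, hp, hs, hn, hdec, rfl⟩
    have hoff : ∀ k, ∀ i j : Fin d, i ≠ j →
        (fun y : Fin d × Fin d => if y.1 = y.2 then ψ k y.1 else 0) (i, j) = 0 := by
      intro k i j hij
      simp [hij]
    refine ⟨K, p, fun k y => if y.1 = y.2 then ψ k y.1 else 0, hp, hs, ?_, ?_, ?_⟩
    · intro k
      rw [sum_prod_diag _ (hoff k)]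
      simpa using hn k
    · ext ⟨i, i'⟩ ⟨j, j'⟩
      rw [hmc, hdec]
      simp only [Matrix.sum_apply, Matrix.smul_apply, Matrix.vecMulVec_apply, Pi.star_apply]
      by_cases h1 : i = i' <;> by_cases h2 : j = j' <;> simp [h1, h2]
    · refine Finset.sum_congr rfl fun k _ => ?_
      rw [vN_ptrace _ (hoff k)]
      simp
  · rintro ⟨K, q, φ, hq, hs, hn, hdec, rfl⟩
    have hd : Nonempty (Fin d) := by
      by_contra hne
      rw [not_nonempty_iff] at hne
      simp [Matrix.trace] at htr
    obtain ⟨i0⟩ := hd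
    have hoff : ∀ k, q k ≠ 0 → ∀ i j, i ≠ j → φ k (i, j) = 0 := by
      intro k hk i j hij
      have h0 := hmc i j i j
      rw [if_neg (by simp [hij]), hdec] at h0
      simp only [Matrix.sum_apply, Matrix.smul_apply, Matrix.vecMulVec_apply, Pi.star_apply] at h0
      have h1 : ∑ k, q k * ‖φ k (i, j)‖ ^ 2 = 0 := by
        have h2 := congrArg Complex.re h0
        simpa [Complex.mul_conj, Complex.normSq_eq_norm_sq, ← Complex.ofReal_pow] using h2
      rw [Finset.sum_eq_zero_iff_of_nonneg
        (fun k _ => mul_nonneg (hq k) (sq_nonneg _))] at h1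
      have h3 := h1 k (Finset.mem_univ k)
      simpa [hk] using h3
    refine ⟨K, q, fun k i => if q k = 0 then (if i = i0 then 1 else 0) else φ k (i, i),
      hq, hs, ?_, ?_, ?_⟩
    · intro k
      by_cases hk : q k = 0
      · simp only [hk, if_true]
        rw [Finset.sum_eq_single i0] <;> simp +contextual
      · simp only [hk, if_false]
        rw [← sum_prod_diag _ (hoff k hk)]
        exact hn k
    · ext i j
      have h0 := hmc i i j j
      rw [if_pos ⟨rfl, rfl⟩] at h0
      rw [← h0, hdec]
      simp only [Matrix.sum_apply, Matrix.smul_apply, Matrix.vecMulVec_apply, Pi.star_apply]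
      refine Finset.sum_congr rfl fun k _ => ?_
      by_cases hk : q k = 0 <;> simp [hk]
    · refine Finset.sum_congr rfl fun k _ => ?_
      by_cases hk : q k = 0
      · simp [hk]
      · rw [vN_ptrace _ (hoff k hk)]
        simp [hk]
end

section
/- Let ρ and σ be density matrices indexed by (Fin m × Fin n) × (Fin m × Fin n), and let T = (1/2)·Σ_i |λ_i(ρ − σ)| be half the trace distance, where λ_i(ρ − σ) are the eigenvalues of the Hermitian matrix ρ − σ. Assume T ≤ 1/2. Define the quantum-incoherent relative entropy by the formula C_r^{A|B}(ρ) = S(Δ^B(ρ)) − S(ρ), where Δ^B zeroes all entries whose two B-indices (second components) differ, and S(X) = −Σ_i λ_i log₂ λ_i is the von Neumann entropy computed from the eigenvalues of the positive semidefinite matrix X. Then |C_r^{A|B}(ρ) − C_r^{A|B}(σ)| ≤ 2·T·log₂(m·n) + 2·h(T), where h(x) = −x log₂ x − (1−x) log₂(1−x) is the binary entropy. -/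
open scoped ComplexOrder

/-- The quantum-incoherent relative entropy `C_r^{A|B}(ρ) = S(Δ^B(ρ)) − S(ρ)`. -/
noncomputable def qiRelEntropy {m n : ℕ}
    (ρ : Matrix (Fin m × Fin n) (Fin m × Fin n) ℂ) : ℝ :=
  vonNeumannEntropy (dephaseB ρ) - vonNeumannEntropy ρ

namespace QI

lemma negMulLog_add_le {x y : ℝ} (hx : 0 ≤ x) (hy : 0 ≤ y) :
    Real.negMulLog (x + y) ≤ Real.negMulLog x + Real.negMulLog y := by
  rcases hx.eq_or_lt with rfl | hx
  · simp
  rcases hy.eq_or_lt with rfl | hy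
  · simp
  have h1 : Real.log x ≤ Real.log (x + y) := Real.log_le_log hx (by linarith)
  have h2 : Real.log y ≤ Real.log (x + y) := Real.log_le_log hy (by linarith)
  simp only [Real.negMulLog]
  nlinarith [mul_le_mul_of_nonneg_left h1 hx.le, mul_le_mul_of_nonneg_left h2 hy.le]

lemma mul_negMulLog_div {c x : ℝ} (hc : 0 < c) :
    c * Real.negMulLog (x / c) = Real.negMulLog x + x * Real.log c := by
  rcases eq_or_ne x 0 with rfl | hx
  · simp
  simp only [Real.negMulLog]
  rw [Real.log_div hx hc.ne']
  field_simp
  ring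

/-- Entropy of a subnormalised distribution of mass `e`. -/
lemma sum_negMulLog_le {ι : Type*} [Fintype ι] [Nonempty ι] (a : ι → ℝ) (ha : ∀ i, 0 ≤ a i) (e : ℝ)
    (he : 0 < e) (hs : ∑ i, a i = e) :
    ∑ i, Real.negMulLog (a i) ≤ e * Real.log (Fintype.card ι) + Real.negMulLog e := by
  have hd : (0 : ℝ) < Fintype.card ι := by exact_mod_cast Fintype.card_pos
  have hJ := Real.concaveOn_negMulLog.le_map_sum (t := Finset.univ)
    (w := fun _ : ι => (Fintype.card ι : ℝ)⁻¹) (p := a) (fun _ _ => by positivity)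
    (by simp [hd.ne']) (fun i _ => ha i)
  simp only [smul_eq_mul, ← Finset.mul_sum, hs] at hJ
  have h3 := mul_negMulLog_div (c := (Fintype.card ι : ℝ)) (x := e) hd
  rw [inv_mul_eq_div, inv_mul_eq_div, div_le_iff₀ hd] at hJ
  linarith

lemma classical_fannes {ι : Type*} [Fintype ι] (p q : ι → ℝ)
    (hp : ∀ i, 0 ≤ p i) (hq : ∀ i, 0 ≤ q i) (hps : ∑ i, p i = 1) (hqs : ∑ i, q i = 1)
    (T : ℝ) (hT : ∑ i, |p i - q i| ≤ 2 * T) (hT2 : T ≤ 1 / 2) :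
    ∑ i, Real.negMulLog (p i) - ∑ i, Real.negMulLog (q i)
      ≤ T * Real.log (Fintype.card ι) + Real.binEntropy T := by
  have hne : Nonempty ι := by
    by_contra h
    rw [not_nonempty_iff] at h
    simp at hps
  have hd : (1 : ℝ) ≤ Fintype.card ι := by exact_mod_cast Fintype.card_pos
  have hlog := Real.log_nonneg hd
  obtain ⟨e, he⟩ : ∃ e, e = (1 / 2) * ∑ i, |p i - q i| := ⟨_, rfl⟩
  have he0 : 0 ≤ e := by rw [he]; positivity
  have heT : e ≤ T := by linarith
  have hmono : Real.binEntropy e ≤ Real.binEntropy T :=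
    Real.binEntropy_strictMonoOn.monotoneOn ⟨he0, by norm_num; linarith⟩
      ⟨by linarith, by norm_num; linarith⟩ heT
  suffices h : ∑ i, Real.negMulLog (p i) - ∑ i, Real.negMulLog (q i)
      ≤ e * Real.log (Fintype.card ι) + Real.binEntropy e by
    have := mul_le_mul_of_nonneg_right heT hlog
    linarith
  rcases he0.eq_or_lt with h0 | hpos
  · have hz : ∑ i, |p i - q i| = 0 := by linarith
    rw [Finset.sum_eq_zero_iff_of_nonneg (fun i _ => abs_nonneg _)] at hz
    have hpq : p = q := by
      ext i
      have := hz i (Finset.mem_univ i)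
      rw [abs_eq_zero] at this
      linarith
    rw [← h0, hpq]
    simp
  have h1e : 0 < 1 - e := by linarith
  let r : ι → ℝ := fun i => (p i + q i - |p i - q i|) / 2
  have hr0 : ∀ i, 0 ≤ r i := fun i => by
    have : |p i - q i| ≤ p i + q i := by
      rw [abs_le]; constructor <;> linarith [hp i, hq i]
    simp only [r]; linarith
  have hrp : ∀ i, 0 ≤ p i - r i := fun i => by
    have := neg_abs_le (p i - q i)
    simp only [r]; linarith
  have hrq : ∀ i, 0 ≤ q i - r i := fun i => by
    have := le_abs_self (p i - q i)
    simp only [r]; linarith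
  have hrs : ∑ i, r i = 1 - e := by
    simp only [r, ← Finset.sum_div, Finset.sum_sub_distrib, Finset.sum_add_distrib, hps, hqs]
    linarith
  have hup : ∑ i, Real.negMulLog (p i)
      ≤ ∑ i, Real.negMulLog (r i) + ∑ i, Real.negMulLog (p i - r i) := by
    rw [← Finset.sum_add_distrib]
    refine Finset.sum_le_sum fun i _ => ?_
    have := negMulLog_add_le (hr0 i) (hrp i)
    rwa [add_sub_cancel] at this
  have ha := sum_negMulLog_le (fun i => p i - r i) hrp e hpos
    (by rw [Finset.sum_sub_distrib, hps, hrs]; ring)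
  have hbs : ∑ i, (q i - r i) = e := by rw [Finset.sum_sub_distrib, hqs, hrs]; ring
  have hlow : ∑ i, (Real.negMulLog (r i) + r i * Real.log (1 - e)) ≤ ∑ i, Real.negMulLog (q i) := by
    refine Finset.sum_le_sum fun i _ => ?_
    have hb1 : q i - r i ≤ e := by
      rw [← hbs]
      exact Finset.single_le_sum (f := fun i => q i - r i) (fun i _ => hrq i) (Finset.mem_univ i)
    have hx1 : r i / (1 - e) ∈ Set.Ici (0 : ℝ) := div_nonneg (hr0 i) h1e.le
    have hy1 : (q i - r i) / e ∈ Set.Ici (0 : ℝ) := div_nonneg (hrq i) he0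
    have hc := Real.concaveOn_negMulLog.2 hx1 hy1 h1e.le he0 (by ring)
    simp only [smul_eq_mul] at hc
    rw [mul_negMulLog_div h1e, mul_div_cancel₀ _ h1e.ne', mul_div_cancel₀ _ hpos.ne',
      add_sub_cancel] at hc
    have := mul_nonneg he0 (Real.negMulLog_nonneg (div_nonneg (hrq i) he0)
      ((div_le_one hpos).2 hb1))
    linarith
  rw [Finset.sum_add_distrib, ← Finset.sum_mul, hrs] at hlow
  rw [Real.binEntropy_eq_negMulLog_add_negMulLog_one_sub]
  have : Real.negMulLog (1 - e) = -((1 - e) * Real.log (1 - e)) := by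
    simp only [Real.negMulLog]; ring
  linarith

section quantum
open Matrix
variable {d : Type*} [Fintype d] [DecidableEq d]

lemma entropy_eq {X : Matrix d d ℂ} (hX : X.IsHermitian) :
    vonNeumannEntropy X = (∑ i, Real.negMulLog (hX.eigenvalues i)) / Real.log 2 := by
  rw [vonNeumannEntropy, dif_pos hX, Finset.sum_div, ← Finset.sum_neg_distrib]
  refine Finset.sum_congr rfl fun i _ => ?_
  simp only [Real.negMulLog, Real.logb]
  ring

lemma diagonalize {X : Matrix d d ℂ} (hX : X.IsHermitian) :
    ∃ U : Matrix d d ℂ, Uᴴ * U = 1 ∧ U * Uᴴ = 1 ∧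
      X = U * diagonal (fun i => (hX.eigenvalues i : ℂ)) * Uᴴ := by
  refine ⟨hX.eigenvectorUnitary, ?_, ?_, ?_⟩
  · exact Unitary.coe_star_mul_self _
  · exact Unitary.coe_mul_star_self _
  · have := hX.spectral_theorem
    rw [Unitary.conjStarAlgAut_apply] at this
    exact this

lemma sum_diag_re {U A : Matrix d d ℂ} (hU' : U * Uᴴ = 1) :
    ∑ i, ((Uᴴ * A * U) i i).re = A.trace.re := by
  have : (Uᴴ * A * U).trace = A.trace := by
    rw [Matrix.trace_mul_comm, ← mul_assoc, hU', one_mul]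
  rw [← this, Matrix.trace, Complex.re_sum]
  rfl

lemma diag_conj (W : Matrix d d ℂ) (l : d → ℝ) (i : d) :
    ((W * diagonal (fun i => (l i : ℂ)) * Wᴴ) i i).re = ∑ k, Complex.normSq (W i k) * l k := by
  rw [Matrix.mul_apply, Complex.re_sum]
  refine Finset.sum_congr rfl fun k _ => ?_
  rw [Matrix.mul_diagonal, Matrix.conjTranspose_apply]
  simp [Complex.normSq_apply]
  ring

lemma row_sum (W : Matrix d d ℂ) (h : W * Wᴴ = 1) (i : d) :
    ∑ k, Complex.normSq (W i k) = 1 := by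
  have := diag_conj W (fun _ => 1) i
  simpa [h] using this.symm

lemma schur {X : Matrix d d ℂ} (hX : X.PosSemidef) {U : Matrix d d ℂ}
    (hU : Uᴴ * U = 1) (hU' : U * Uᴴ = 1) :
    ∑ i, Real.negMulLog (hX.1.eigenvalues i)
      ≤ ∑ i, Real.negMulLog ((Uᴴ * X * U) i i).re := by
  obtain ⟨V, hV, hV', hXV⟩ := diagonalize hX.1
  obtain ⟨W, hW⟩ : ∃ W, W = Uᴴ * V := ⟨_, rfl⟩
  have hWs : Wᴴ = Vᴴ * U := by rw [hW, conjTranspose_mul, conjTranspose_conjTranspose]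
  have h1 : W * Wᴴ = 1 := by
    rw [hWs, hW, mul_assoc, ← mul_assoc V, hV', one_mul, hU]
  have h2 : Wᴴ * W = 1 := by
    rw [hWs, hW, mul_assoc, ← mul_assoc U, hU', one_mul, hV]
  have hdiag : ∀ i, ((Uᴴ * X * U) i i).re
      = ∑ k, Complex.normSq (W i k) * hX.1.eigenvalues k := fun i => by
    rw [← diag_conj, hWs, hW]
    conv_lhs => rw [hXV]
    simp only [mul_assoc]
  have hcol : ∀ k, ∑ i, Complex.normSq (W i k) = 1 := fun k => by
    have := row_sum Wᴴ (by rw [conjTranspose_conjTranspose, h2]) k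
    simpa using this
  calc ∑ k, Real.negMulLog (hX.1.eigenvalues k)
      = ∑ k, ∑ i, Complex.normSq (W i k) * Real.negMulLog (hX.1.eigenvalues k) := by
        refine Finset.sum_congr rfl fun k _ => ?_
        rw [← Finset.sum_mul, hcol, one_mul]
    _ = ∑ i, ∑ k, Complex.normSq (W i k) * Real.negMulLog (hX.1.eigenvalues k) :=
        Finset.sum_comm
    _ ≤ _ := by
        refine Finset.sum_le_sum fun i _ => ?_
        rw [hdiag]
        exact Real.concaveOn_negMulLog.le_map_sum (t := Finset.univ)
          (fun k _ => Complex.normSq_nonneg _) (row_sum W h1 i)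
          (fun k _ => hX.eigenvalues_nonneg k)

lemma fannes_one {ρ σ A B : Matrix d d ℂ} (hρ : ρ.PosSemidef) (hρt : ρ.trace = 1)
    (hσ : σ.PosSemidef) (hσt : σ.trace = 1) (hA : A.PosSemidef) (hB : B.PosSemidef)
    (hAB : ρ - σ = A - B) (T : ℝ) (hT : A.trace.re + B.trace.re ≤ 2 * T) (hT2 : T ≤ 1 / 2) :
    ∑ i, Real.negMulLog (hρ.1.eigenvalues i) - ∑ i, Real.negMulLog (hσ.1.eigenvalues i)
      ≤ T * Real.log (Fintype.card d) + Real.binEntropy T := by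
  obtain ⟨U, hU, hU', hσU⟩ := diagonalize hσ.1
  have hnn : ∀ {M : Matrix d d ℂ}, M.PosSemidef → ∀ i, 0 ≤ ((Uᴴ * M * U) i i).re :=
    fun hM i => (Complex.le_def.1 (hM.conjTranspose_mul_mul_same U).diag_nonneg).1
  have hdσ : ∀ i, ((Uᴴ * σ * U) i i).re = hσ.1.eigenvalues i := fun i => by
    have : Uᴴ * σ * U = diagonal (fun i => (hσ.1.eigenvalues i : ℂ)) := by
      conv_lhs => rw [hσU]
      simp only [mul_assoc, hU, mul_one]
      rw [← mul_assoc, hU, one_mul]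
    rw [this]; simp
  have hsch := schur hρ hU hU'
  have hcl := classical_fannes (fun i => ((Uᴴ * ρ * U) i i).re) (fun i => ((Uᴴ * σ * U) i i).re)
    (hnn hρ) (hnn hσ) (by rw [sum_diag_re hU', hρt]; simp) (by rw [sum_diag_re hU', hσt]; simp)
    T ?_ hT2
  · simp only [hdσ] at hcl
    linarith
  · refine le_trans ?_ hT
    rw [← sum_diag_re hU', ← sum_diag_re (A := B) hU', ← Finset.sum_add_distrib]
    refine Finset.sum_le_sum fun i _ => ?_
    have : ((Uᴴ * ρ * U) i i).re - ((Uᴴ * σ * U) i i).re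
        = ((Uᴴ * A * U) i i).re - ((Uᴴ * B * U) i i).re := by
      rw [← Complex.sub_re, ← Complex.sub_re, ← Matrix.sub_apply, ← Matrix.sub_apply,
        ← sub_mul, ← sub_mul, ← mul_sub, ← mul_sub, hAB]
    rw [this, abs_le]
    constructor <;> linarith [hnn hA i, hnn hB i]

lemma fannes {ρ σ A B : Matrix d d ℂ} (hρ : ρ.PosSemidef) (hρt : ρ.trace = 1)
    (hσ : σ.PosSemidef) (hσt : σ.trace = 1) (hA : A.PosSemidef) (hB : B.PosSemidef)
    (hAB : ρ - σ = A - B) (T : ℝ) (hT : A.trace.re + B.trace.re ≤ 2 * T) (hT2 : T ≤ 1 / 2) :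
    |vonNeumannEntropy ρ - vonNeumannEntropy σ|
      ≤ T * Real.logb 2 (Fintype.card d) + binEntropy T := by
  have h1 := fannes_one hρ hρt hσ hσt hA hB hAB T hT hT2
  have h2 := fannes_one hσ hσt hρ hρt hB hA (by rw [← neg_sub, hAB, neg_sub]) T (by linarith) hT2
  have hl : 0 < Real.log 2 := Real.log_pos (by norm_num)
  have hR : T * Real.logb 2 (Fintype.card d) + binEntropy T
      = (T * Real.log (Fintype.card d) + Real.binEntropy T) / Real.log 2 := by
    rw [Real.binEntropy_eq_negMulLog_add_negMulLog_one_sub]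
    simp only [binEntropy, Real.logb, Real.negMulLog]
    ring
  rw [hR, entropy_eq hρ.1, entropy_eq hσ.1, ← sub_div, abs_div, abs_of_pos hl]
  gcongr
  rw [abs_le]
  constructor <;> linarith

lemma jordan {X : Matrix d d ℂ} (hX : X.IsHermitian) :
    ∃ A B : Matrix d d ℂ, A.PosSemidef ∧ B.PosSemidef ∧ X = A - B ∧
      A.trace.re + B.trace.re = ∑ i, |hX.eigenvalues i| := by
  obtain ⟨U, hU, hU', hXU⟩ := diagonalize hX
  have hps : ∀ f : d → ℝ, (∀ i, 0 ≤ f i) → (U * diagonal (fun i => (f i : ℂ)) * Uᴴ).PosSemidef := by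
    intro f hf
    refine PosSemidef.mul_mul_conjTranspose_same (PosSemidef.diagonal ?_) U
    intro i
    exact Complex.zero_le_real.2 (hf i)
  have htr : ∀ f : d → ℝ, (U * diagonal (fun i => (f i : ℂ)) * Uᴴ).trace.re = ∑ i, f i := by
    intro f
    rw [Matrix.trace_mul_comm, ← mul_assoc, hU, one_mul, Matrix.trace_diagonal, Complex.re_sum]
    simp
  refine ⟨_, _, hps (fun i => max (hX.eigenvalues i) 0) (fun i => le_max_right _ _),
    hps (fun i => max (-hX.eigenvalues i) 0) (fun i => le_max_right _ _), ?_, ?_⟩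
  · rw [← sub_mul, ← mul_sub, diagonal_sub]
    conv_lhs => rw [hXU]
    congr 3
    ext i
    rw [← Complex.ofReal_sub]
    congr 1
    rcases le_total 0 (hX.eigenvalues i) with h | h
    · rw [max_eq_left h, max_eq_right (by linarith)]; ring
    · rw [max_eq_right h, max_eq_left (by linarith)]; ring
  · rw [htr, htr, ← Finset.sum_add_distrib]
    refine Finset.sum_congr rfl fun i _ => ?_
    rcases le_total 0 (hX.eigenvalues i) with h | h
    · rw [max_eq_left h, max_eq_right (by linarith), abs_of_nonneg h]; ring
    · rw [max_eq_right h, max_eq_left (by linarith), abs_of_nonpos h]; ring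

end quantum

section dephase
open Matrix
variable {m n : ℕ}

lemma dephaseB_trace (X : Matrix (Fin m × Fin n) (Fin m × Fin n) ℂ) :
    (dephaseB X).trace = X.trace := by
  simp [Matrix.trace, dephaseB]

lemma dephaseB_sub (X Y : Matrix (Fin m × Fin n) (Fin m × Fin n) ℂ) :
    dephaseB (X - Y) = dephaseB X - dephaseB Y := by
  ext p q
  simp only [dephaseB, Matrix.of_apply, Matrix.sub_apply]
  split_ifs <;> simp

lemma dephaseB_psd {X : Matrix (Fin m × Fin n) (Fin m × Fin n) ℂ} (hX : X.PosSemidef) :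
    (dephaseB X).PosSemidef := by
  have : dephaseB X = ∑ j : Fin n,
      (diagonal (fun p : Fin m × Fin n => if p.2 = j then (1 : ℂ) else 0)) * X *
      (diagonal (fun p : Fin m × Fin n => if p.2 = j then (1 : ℂ) else 0))ᴴ := by
    ext p q
    rw [Matrix.sum_apply]
    simp only [dephaseB, Matrix.of_apply, Matrix.diagonal_conjTranspose, Matrix.mul_diagonal,
      Matrix.diagonal_mul, Pi.star_apply, apply_ite star, star_one, star_zero]
    simp [eq_comm]
  rw [this]
  exact posSemidef_sum _ fun j _ => hX.mul_mul_conjTranspose_same _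

end dephase

end QI

/-- asymptotic continuity of the QI relative entropy, appendix proof of
Theorem 3.  For density matrices `ρ, σ` on `ℂ^m ⊗ ℂ^n` at trace distance
`T = (1/2) Σ_i |λ_i(ρ − σ)| ≤ 1/2`,
`|C_r^{A|B}(ρ) − C_r^{A|B}(σ)| ≤ 2T log₂(mn) + 2h(T)`. -/
theorem qiRelEntropy_continuity
    (m n : ℕ) (ρ σ : Matrix (Fin m × Fin n) (Fin m × Fin n) ℂ)
    (hρ : ρ.PosSemidef) (hρtr : ρ.trace = 1)
    (hσ : σ.PosSemidef) (hσtr : σ.trace = 1)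
    (hH : (ρ - σ).IsHermitian) (T : ℝ)
    (hT : T = (1 / 2) * ∑ i, |hH.eigenvalues i|)
    (hThalf : T ≤ 1 / 2) :
    |qiRelEntropy ρ - qiRelEntropy σ|
      ≤ 2 * T * Real.logb 2 (m * n) + 2 * binEntropy T := by
  obtain ⟨A, B, hA, hB, hAB, htr⟩ := QI.jordan hH
  have hT' : A.trace.re + B.trace.re ≤ 2 * T := by linarith
  have h1 := QI.fannes hρ hρtr hσ hσtr hA hB hAB T hT' hThalf
  have h2 := QI.fannes (QI.dephaseB_psd hρ) (by rw [QI.dephaseB_trace, hρtr])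
    (QI.dephaseB_psd hσ) (by rw [QI.dephaseB_trace, hσtr]) (QI.dephaseB_psd hA)
    (QI.dephaseB_psd hB) (by rw [← QI.dephaseB_sub, ← QI.dephaseB_sub, hAB]) T
    (by rwa [QI.dephaseB_trace, QI.dephaseB_trace]) hThalf
  have hcard : ((Fintype.card (Fin m × Fin n) : ℕ) : ℝ) = m * n := by simp
  rw [hcard] at h1 h2
  rw [abs_le] at h1 h2 ⊢
  simp only [qiRelEntropy]
  constructor <;> linarith [h1.1, h1.2, h2.1, h2.2]
end

section
/- Let a, d ≥ 1, let O : Fin d → Fin d → Matrix (Fin a) (Fin a) ℂ be a family of a×a complex matrices such that the matrix ρ̃ indexed by (Fin a × Fin d × Fin d) × (Fin a × Fin d × Fin d), defined by ρ̃_{(x,i,i'),(y,j,j')} = (O i j)_{x,y} if i = i' and j = j', and 0 otherwise, is positive semidefinite. Let c : Fin d → ℂ and f : Fin d → Fin d, and define the real numbers p = Re( Σ_{i,j : f(i) = f(j)} c_i · conj(c_j) · Tr(O i j) ) and q = Σ_i |c_i|² · Re(Tr(O i i)). If p > 0 then q > 0. -/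
open scoped ComplexOrder

theorem psd_row_zero {n : Type*} (A : Matrix n n ℂ) (hA : A.PosSemidef)
    (i j : n) (h : A i i = 0) : A i j = 0 := by
  have h2 := (hA.submatrix ![i, j]).det_nonneg
  have h3 : star (A i j) = A j i := hA.isHermitian.apply j i
  rw [Matrix.det_fin_two] at h2
  simp only [Matrix.submatrix_apply, Matrix.cons_val_zero, Matrix.cons_val_one, h, zero_mul,
    zero_sub, ← h3] at h2
  have h4 : A i j * star (A i j) = ((Complex.normSq (A i j) : ℝ) : ℂ) := Complex.mul_conj _
  rw [h4, ← Complex.ofReal_neg] at h2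
  have h5 : 0 ≤ -Complex.normSq (A i j) := by exact_mod_cast h2
  exact Complex.normSq_eq_zero.mp (le_antisymm (by linarith) (Complex.normSq_nonneg _))

/-- appendix "Relating LQICC and tripartite SLOCC maps".  Let
`ρ̃ = Σ_{i,j} O_{ij} ⊗ |ii⟩⟨jj|` be a positive semidefinite maximally correlated
extension of `ρ = Σ_{i,j} O_{ij} ⊗ |i⟩⟨j|`, let `K = Σ_i c_i |f(i)⟩⟨i|` be an
incoherent Kraus operator, let
`p = Re(Σ_{i,j : f(i)=f(j)} c_i conj(c_j) Tr(O i j))` be the probability of the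
corresponding outcome on `ρ`, and let `q = Σ_i |c_i|² Re(Tr(O i i))` be the probability
of the same outcome on `ρ̃`.  Then `p > 0` implies `q > 0`. -/
theorem lqicc_outcome_implies_slocc_outcome
    (a d : ℕ) (ha : 1 ≤ a) (hd : 1 ≤ d)
    (O : Fin d → Fin d → Matrix (Fin a) (Fin a) ℂ)
    (ρt : Matrix (Fin a × Fin d × Fin d) (Fin a × Fin d × Fin d) ℂ)
    (hρt : ∀ x i i' y j j', ρt (x, i, i') (y, j, j') =
      if i = i' ∧ j = j' then (O i j) x y else 0)
    (hpsd : ρt.PosSemidef)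
    (c : Fin d → ℂ) (f : Fin d → Fin d) (p q : ℝ)
    (hp : p = (∑ i, ∑ j, if f i = f j
        then c i * (starRingEnd ℂ) (c j) * (O i j).trace else 0).re)
    (hq : q = ∑ i, ‖c i‖ ^ 2 * ((O i i).trace).re)
    (hpos : 0 < p) : 0 < q := by
  have hdiag : ∀ i x, 0 ≤ O i i x x := by
    intro i x
    have h := hpsd.diag_nonneg (i := (x, i, i))
    rw [hρt] at h
    simpa using h
  have htr : ∀ i, ((O i i).trace).re = ∑ x, (O i i x x).re := by
    intro i
    simp [Matrix.trace]
  have hre : ∀ i x, 0 ≤ (O i i x x).re := fun i x => (Complex.le_def.mp (hdiag i x)).1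
  have hnn : ∀ i, 0 ≤ ‖c i‖ ^ 2 * ((O i i).trace).re := by
    intro i
    rw [htr]
    exact mul_nonneg (by positivity) (Finset.sum_nonneg fun x _ => hre i x)
  by_contra hcon
  have hq0 : ∑ i, ‖c i‖ ^ 2 * ((O i i).trace).re = 0 :=
    le_antisymm (by linarith) (Finset.sum_nonneg fun i _ => hnn i)
  rw [Finset.sum_eq_zero_iff_of_nonneg fun i _ => hnn i] at hq0
  have hz : (∑ i, ∑ j, if f i = f j
        then c i * (starRingEnd ℂ) (c j) * (O i j).trace else 0) = 0 := by
    refine Finset.sum_eq_zero fun i _ => Finset.sum_eq_zero fun j _ => ?_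
    split_ifs with hf
    · rcases mul_eq_zero.mp (hq0 i (Finset.mem_univ i)) with h | h
      · have hc : c i = 0 := by simpa using h
        simp [hc]
      · rw [htr, Finset.sum_eq_zero_iff_of_nonneg fun x _ => hre i x] at h
        have ht : (O i j).trace = 0 := by
          refine Finset.sum_eq_zero fun x _ => ?_
          have hxx : O i i x x = 0 :=
            Complex.ext (h x (Finset.mem_univ x)) (Complex.le_def.mp (hdiag i x)).2.symm
          have hr := psd_row_zero ρt hpsd (x, i, i) (x, j, j) (by rw [hρt]; simpa using hxx)
          rw [hρt] at hr
          simpa using hr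
        rw [ht, mul_zero]
    · rfl
  rw [hz] at hp
  simp at hp
  linarith
end
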